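/- Let u(q,t) be a C² potential, 1-periodic in q, satisfying ∫₀¹ u_q(q,t)² dq < K for all t with the force F = u_q not identically zero. Then there is no C² family f(α,q,t) of globally defined classical solutions of the forced Burgers equation f_t + f·f_q + u_q = 0, 1-periodic in q, such that for each (q,t) the map α ↦ f(α,q,t) is a C² diffeomorphism of ℝ. Equivalently, for any foliated initial data, some solution develops a shock (fails to extend as a classical solution) in finite positive or negative time. -/

import Mathlib

open MeasureTheory Set Filter Topology

/-- The integral over the box `[-A, A] × [0, 1] × [-S, S]`, in the coordinates `(α, q, t)`. -/
noncomputable def boxIntegral (A S : ℝ) (h : ℝ × ℝ × ℝ → ℝ) : ℝ :=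
  ∫ t in (-S)..S, ∫ q in (0 : ℝ)..1, ∫ α in (-A)..A, h (α, q, t)

section BoxIntegral

variable {A S A' S' : ℝ} {g h : ℝ × ℝ × ℝ → ℝ}

theorem continuous_integral_fst (hh : Continuous h) (t : ℝ) :
    Continuous fun q => ∫ α in (-A)..A, h (α, q, t) := by
  fun_prop

theorem continuous_integral_fst_snd (hh : Continuous h) :
    Continuous fun t => ∫ q in (0 : ℝ)..1, ∫ α in (-A)..A, h (α, q, t) := by
  fun_prop

theorem boxIntegral_add (hg : Continuous g) (hh : Continuous h) :
    boxIntegral A S (fun x => g x + h x) = boxIntegral A S g + boxIntegral A S h := by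
  unfold boxIntegral
  rw [← intervalIntegral.integral_add (Continuous.intervalIntegrable (by fun_prop) _ _)
    (Continuous.intervalIntegrable (by fun_prop) _ _)]
  congr 1 with t
  rw [← intervalIntegral.integral_add (Continuous.intervalIntegrable (by fun_prop) _ _)
    (Continuous.intervalIntegrable (by fun_prop) _ _)]
  congr 1 with q
  rw [← intervalIntegral.integral_add (Continuous.intervalIntegrable (by fun_prop) _ _)
    (Continuous.intervalIntegrable (by fun_prop) _ _)]

theorem boxIntegral_const_mul (c : ℝ) :
    boxIntegral A S (fun x => c * h x) = c * boxIntegral A S h := by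
  simp only [boxIntegral, intervalIntegral.integral_const_mul]

theorem boxIntegral_mono (hA : 0 ≤ A) (hS : 0 ≤ S) (hg : Continuous g) (hh : Continuous h)
    (hgh : ∀ α ∈ Icc (-A) A, ∀ q ∈ Icc (0 : ℝ) 1, ∀ t ∈ Icc (-S) S, g (α, q, t) ≤ h (α, q, t)) :
    boxIntegral A S g ≤ boxIntegral A S h := by
  refine intervalIntegral.integral_mono_on (by linarith)
    (Continuous.intervalIntegrable (by fun_prop) _ _)
    (Continuous.intervalIntegrable (by fun_prop) _ _) fun t ht => ?_
  refine intervalIntegral.integral_mono_on zero_le_one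
    (Continuous.intervalIntegrable (by fun_prop) _ _)
    (Continuous.intervalIntegrable (by fun_prop) _ _) fun q hq => ?_
  exact intervalIntegral.integral_mono_on (by linarith)
    (Continuous.intervalIntegrable (by fun_prop) _ _)
    (Continuous.intervalIntegrable (by fun_prop) _ _) fun α hα => hgh α hα q hq t ht

theorem boxIntegral_mono_box (hA : 0 ≤ A) (hS : 0 ≤ S) (hAA : A ≤ A') (hSS : S ≤ S')
    (hh : Continuous h) (h0 : ∀ x, 0 ≤ h x) :
    boxIntegral A S h ≤ boxIntegral A' S' h := by
  calc boxIntegral A S h ≤ boxIntegral A' S h := by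
        refine intervalIntegral.integral_mono_on (by linarith)
          (Continuous.intervalIntegrable (by fun_prop) _ _)
          (Continuous.intervalIntegrable (by fun_prop) _ _) fun t _ => ?_
        refine intervalIntegral.integral_mono_on zero_le_one
          (Continuous.intervalIntegrable (by fun_prop) _ _)
          (Continuous.intervalIntegrable (by fun_prop) _ _) fun q _ => ?_
        exact intervalIntegral.integral_mono_interval (by linarith) (by linarith) hAA
          (Eventually.of_forall fun α => h0 _) (Continuous.intervalIntegrable (by fun_prop) _ _)
    _ ≤ boxIntegral A' S' h :=
        intervalIntegral.integral_mono_interval (by linarith) (by linarith) hSS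
          (Eventually.of_forall fun t => intervalIntegral.integral_nonneg zero_le_one fun q _ =>
            intervalIntegral.integral_nonneg (by linarith) fun α _ => h0 _)
          (Continuous.intervalIntegrable (by fun_prop) _ _)

theorem boxIntegral_pos (hA : 0 < A) (hS : 0 < S) (hh : Continuous h) (h0 : ∀ x, 0 ≤ h x)
    {α q t : ℝ} (hα : α ∈ Icc (-A) A) (hq : q ∈ Icc (0 : ℝ) 1) (ht : t ∈ Icc (-S) S)
    (hpos : 0 < h (α, q, t)) : 0 < boxIntegral A S h := by
  refine intervalIntegral.integral_pos (by linarith) (Continuous.continuousOn (by fun_prop))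
    (fun t _ => intervalIntegral.integral_nonneg zero_le_one fun q _ =>
      intervalIntegral.integral_nonneg (by linarith) fun α _ => h0 _) ⟨t, ht, ?_⟩
  refine intervalIntegral.integral_pos zero_lt_one (Continuous.continuousOn (by fun_prop))
    (fun q _ => intervalIntegral.integral_nonneg (by linarith) fun α _ => h0 _) ⟨q, hq, ?_⟩
  exact intervalIntegral.integral_pos (by linarith) (Continuous.continuousOn (by fun_prop))
    (fun α _ => h0 _) ⟨α, hα, hpos⟩

theorem intervalIntegral_swap_of_continuous {k : ℝ → ℝ → ℝ}
    (hk : Continuous (Function.uncurry k)) (a b c d : ℝ) :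
    ∫ x in a..b, ∫ y in c..d, k x y = ∫ y in c..d, ∫ x in a..b, k x y :=
  intervalIntegral_intervalIntegral_swap
    ((hk.continuousOn.integrableOn_compact (isCompact_uIcc.prod isCompact_uIcc)).mono_set
      (prod_mono uIoc_subset_uIcc uIoc_subset_uIcc))

theorem boxIntegral_eq_zero_of_hasDerivAt_fst_snd (hh : Continuous h)
    (hd : ∀ α q t, HasDerivAt (fun q' => g (α, q', t)) (h (α, q, t)) q)
    (hper : ∀ α t, g (α, 1, t) = g (α, 0, t)) : boxIntegral A S h = 0 := by
  have key : ∀ t, ∫ q in (0 : ℝ)..1, ∫ α in (-A)..A, h (α, q, t) = 0 := fun t => by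
    rw [intervalIntegral_swap_of_continuous (k := fun q α => h (α, q, t)) (by fun_prop)]
    have : ∀ α, ∫ q in (0 : ℝ)..1, h (α, q, t) = 0 := fun α => by
      rw [intervalIntegral.integral_eq_sub_of_hasDerivAt (fun q _ => hd α q t)
        (Continuous.intervalIntegrable (by fun_prop) _ _), hper, sub_self]
    simp [this]
  simp [boxIntegral, key]

theorem boxIntegral_eq_zero_of_hasDerivAt_snd_snd (hh : Continuous h)
    (hd : ∀ α q t, HasDerivAt (fun t' => g (α, q, t')) (h (α, q, t)) t)
    (hS : ∀ α q, g (α, q, S) = 0) (hS' : ∀ α q, g (α, q, -S) = 0) : boxIntegral A S h = 0 := by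
  unfold boxIntegral
  rw [intervalIntegral_swap_of_continuous
    (k := fun t q => ∫ α in (-A)..A, h (α, q, t)) (by fun_prop)]
  have key : ∀ q, ∫ t in (-S)..S, ∫ α in (-A)..A, h (α, q, t) = 0 := fun q => by
    rw [intervalIntegral_swap_of_continuous (k := fun t α => h (α, q, t)) (by fun_prop)]
    have : ∀ α, ∫ t in (-S)..S, h (α, q, t) = 0 := fun α => by
      rw [intervalIntegral.integral_eq_sub_of_hasDerivAt (fun t _ => hd α q t)
        (Continuous.intervalIntegrable (by fun_prop) _ _), hS, hS', sub_self]
    simp [this]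
  simp [key]

end BoxIntegral

theorem hasDerivAt_max_zero_sq (x : ℝ) :
    HasDerivAt (fun y : ℝ => (max y 0) ^ 2) (2 * max x 0) x := by
  rcases lt_trichotomy x 0 with hx | rfl | hx
  · rw [max_eq_right hx.le, mul_zero]
    refine (hasDerivAt_const x (0 : ℝ)).congr_of_eventuallyEq ?_
    filter_upwards [gt_mem_nhds hx] with y hy
    simp [max_eq_right hy.le]
  · simp only [max_self, mul_zero]
    rw [hasDerivAt_iff_isLittleO_nhds_zero]
    refine Asymptotics.IsBigO.trans_isLittleO (g := fun y : ℝ => y ^ 2) ?_ ?_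
    · refine Asymptotics.IsBigO.of_bound 1 (Eventually.of_forall fun y => ?_)
      rcases le_total y 0 with hy | hy <;> simp [hy, sq_nonneg]
    · simpa using Asymptotics.isLittleO_pow_id (𝕜 := ℝ) (n := 2) (by norm_num)
  · rw [max_eq_left hx.le]
    refine HasDerivAt.congr_of_eventuallyEq (f := fun y : ℝ => y ^ 2) ?_ ?_
    · simpa using hasDerivAt_pow 2 x
    · filter_upwards [lt_mem_nhds hx] with y hy
      simp [max_eq_left hy.le]

theorem contDiff_max_zero_sq : ContDiff ℝ 1 (fun y : ℝ => (max y 0) ^ 2) := by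
  refine contDiff_one_iff_deriv.2 ⟨fun x => (hasDerivAt_max_zero_sq x).differentiableAt, ?_⟩
  rw [funext fun x => (hasDerivAt_max_zero_sq x).deriv]
  fun_prop

/-- The profile whose positive part, squared, is the logarithmic cutoff on the `(p, t)` plane. -/
noncomputable def logProfile (N p t : ℝ) : ℝ := 1 - Real.log (1 + p ^ 2 + t ^ 2) / N

/-- A `C¹` cutoff on the `(p, t)` plane, whose Dirichlet energy tends to `0` as `N → ∞`. -/
noncomputable def logCutoff (N p t : ℝ) : ℝ := (max (logProfile N p t) 0) ^ 2

theorem one_add_sq_add_sq_pos (p t : ℝ) : 0 < 1 + p ^ 2 + t ^ 2 := by positivity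

theorem contDiff_logProfile (N : ℝ) :
    ContDiff ℝ 1 (fun x : ℝ × ℝ => logProfile N x.1 x.2) := by
  unfold logProfile
  refine contDiff_const.sub (ContDiff.div_const (ContDiff.log (by fun_prop) fun x => ?_) _)
  exact (one_add_sq_add_sq_pos _ _).ne'

theorem contDiff_logCutoff (N : ℝ) :
    ContDiff ℝ 1 (fun x : ℝ × ℝ => logCutoff N x.1 x.2) :=
  contDiff_max_zero_sq.comp (contDiff_logProfile N)

theorem hasDerivAt_logCutoff (N : ℝ) {p t : ℝ → ℝ} {p' t' x : ℝ} (hp : HasDerivAt p p' x)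
    (ht : HasDerivAt t t' x) :
    HasDerivAt (fun y => logCutoff N (p y) (t y))
      (2 * max (logProfile N (p x) (t x)) 0 *
        (-((2 * p x * p' + 2 * t x * t') / (1 + p x ^ 2 + t x ^ 2) / N))) x := by
  have h1 : HasDerivAt (fun y => 1 + p y ^ 2 + t y ^ 2) (2 * p x * p' + 2 * t x * t') x := by
    simpa using ((hp.fun_pow 2).const_add 1).fun_add (ht.fun_pow 2)
  exact (hasDerivAt_max_zero_sq (logProfile N (p x) (t x))).comp x
    (((h1.log (one_add_sq_add_sq_pos _ _).ne').div_const N).const_sub 1)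

theorem logCutoff_eq_zero {N p t : ℝ} (hN : 0 < N) (h : Real.exp N ≤ 1 + p ^ 2 + t ^ 2) :
    logCutoff N p t = 0 := by
  have : N ≤ Real.log (1 + p ^ 2 + t ^ 2) :=
    (Real.le_log_iff_exp_le (one_add_sq_add_sq_pos _ _)).2 h
  have : 1 ≤ Real.log (1 + p ^ 2 + t ^ 2) / N := by rwa [le_div_iff₀ hN, one_mul]
  rw [logCutoff, max_eq_right (by unfold logProfile; linarith)]
  norm_num

theorem one_fourth_le_logCutoff {N p t : ℝ} (hN : 0 < N)
    (h : Real.log (1 + p ^ 2 + t ^ 2) ≤ N / 2) : 1 / 4 ≤ logCutoff N p t := by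
  have : Real.log (1 + p ^ 2 + t ^ 2) / N ≤ 1 / 2 := by rw [div_le_iff₀ hN]; linarith
  have h2 : 1 / 2 ≤ max (logProfile N p t) 0 := le_max_of_le_left (by unfold logProfile; linarith)
  unfold logCutoff
  nlinarith

theorem exp_le_one_add_sinh_sq {N : ℝ} (hN : 1 ≤ N) :
    Real.exp N ≤ 1 + Real.sinh (2 * N) ^ 2 := by
  have h1 : Real.exp (2 * N) / 2 ≤ Real.cosh (2 * N) := by
    rw [Real.cosh_eq]; linarith [Real.exp_pos (-(2 * N))]
  have h2 : Real.exp (2 * N) = Real.exp N ^ 2 := by rw [← Real.exp_nat_mul]; norm_num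
  have h3 : 2 ≤ Real.exp N := by linarith [Real.add_one_le_exp N]
  have h4 := Real.cosh_sq (2 * N)
  have h5 : Real.exp N ≤ Real.exp N ^ 2 / 2 := by nlinarith
  have h6 : 1 ≤ Real.exp N := by linarith
  nlinarith

theorem integral_inv_sqrt_one_add_sq (S : ℝ) :
    ∫ t in (-S)..S, (√(1 + t ^ 2))⁻¹ = 2 * Real.arsinh S := by
  rw [intervalIntegral.integral_eq_sub_of_hasDerivAt (fun t _ => Real.hasDerivAt_arsinh t),
    Real.arsinh_neg]
  · ring
  · refine Continuous.intervalIntegrable ?_ _ _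
    refine Continuous.inv₀ (by fun_prop) fun t => ?_
    positivity

/-- The pointwise estimate behind the energy inequality. -/
theorem cutoff_young_le {N w m p t v : ℝ} :
    w * (2 * m * (-((2 * p * (-v) + 2 * t) / (1 + p ^ 2 + t ^ 2) / N))) ≤
      1 / 2 * (w ^ 2 * m ^ 2) + 8 / N ^ 2 * ((1 + v ^ 2) / (1 + p ^ 2 + t ^ 2)) := by
  set Z := 1 + p ^ 2 + t ^ 2 with hZ
  have hZ0 : 0 < Z := one_add_sq_add_sq_pos p t
  set X := (2 * p * (-v) + 2 * t) / Z / N with hX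
  have hX2 : X ^ 2 ≤ 4 / N ^ 2 * ((1 + v ^ 2) / Z) := by
    have e1 : X ^ 2 = 4 / N ^ 2 * ((t - p * v) ^ 2 / Z / Z) := by rw [hX]; ring
    rw [e1]
    gcongr
    rw [div_le_iff₀ hZ0]
    nlinarith [sq_nonneg (t * v + p), sq_nonneg v]
  have e2 : 8 / N ^ 2 * ((1 + v ^ 2) / Z) = 2 * (4 / N ^ 2 * ((1 + v ^ 2) / Z)) := by ring
  nlinarith [sq_nonneg (w * m + 2 * X)]

section PartialDerivatives

variable {X : ℝ × ℝ × ℝ → ℝ}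

theorem hasDerivAt_fst_of_differentiable (hX : Differentiable ℝ X) (α q t : ℝ) :
    HasDerivAt (fun α' => X (α', q, t)) (fderiv ℝ X (α, q, t) (1, 0, 0)) α :=
  (hX (α, q, t)).hasFDerivAt.comp_hasDerivAt (f := fun α' => (α', q, t)) α
    ((hasDerivAt_id α).prodMk ((hasDerivAt_const α q).prodMk (hasDerivAt_const α t)))

theorem hasDerivAt_fst_snd_of_differentiable (hX : Differentiable ℝ X) (α q t : ℝ) :
    HasDerivAt (fun q' => X (α, q', t)) (fderiv ℝ X (α, q, t) (0, 1, 0)) q :=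
  (hX (α, q, t)).hasFDerivAt.comp_hasDerivAt (f := fun q' => (α, q', t)) q
    ((hasDerivAt_const q α).prodMk ((hasDerivAt_id q).prodMk (hasDerivAt_const q t)))

theorem hasDerivAt_snd_snd_of_differentiable (hX : Differentiable ℝ X) (α q t : ℝ) :
    HasDerivAt (fun t' => X (α, q, t')) (fderiv ℝ X (α, q, t) (0, 0, 1)) t :=
  (hX (α, q, t)).hasFDerivAt.comp_hasDerivAt (f := fun t' => (α, q, t')) t
    ((hasDerivAt_const t α).prodMk ((hasDerivAt_const t q).prodMk (hasDerivAt_id t)))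

variable {E : Type*} [NormedAddCommGroup E] [NormedSpace ℝ E] {Y : E → ℝ}

theorem contDiff_one_fderiv_apply (hY : ContDiff ℝ 2 Y) (v : E) :
    ContDiff ℝ 1 (fun x => fderiv ℝ Y x v) :=
  (hY.fderiv_right (m := 1) (by norm_num)).clm_apply contDiff_const

theorem continuous_fderiv_apply (hY : ContDiff ℝ 1 Y) (v : E) :
    Continuous (fun x => fderiv ℝ Y x v) :=
  (hY.continuous_fderiv (by norm_num)).clm_apply continuous_const

theorem fderiv_fderiv_apply_comm (hY : ContDiff ℝ 2 Y) (x v w : E) :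
    fderiv ℝ (fun y => fderiv ℝ Y y v) x w = fderiv ℝ (fun y => fderiv ℝ Y y w) x v := by
  have hd : DifferentiableAt ℝ (fderiv ℝ Y) x :=
    (hY.fderiv_right (m := 1) (by norm_num)).differentiable (by norm_num) x
  rw [fderiv_clm_apply hd (differentiableAt_const _),
    fderiv_clm_apply hd (differentiableAt_const _)]
  simpa using (hY.contDiffAt.isSymmSndFDerivAt (by simp)).eq w v

end PartialDerivatives

/-- A global `C²` family `F(α, q, t)` of solutions of the Burgers equation forced by the potential
`U(q, t)`, whose graphs foliate the cylinder in the increasing direction. -/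
structure IsBurgersFoliation (U : ℝ × ℝ → ℝ) (F : ℝ × ℝ × ℝ → ℝ) : Prop where
  contDiff_potential : ContDiff ℝ 2 U
  potential_periodic : ∀ q t, U (q + 1, t) = U (q, t)
  contDiff : ContDiff ℝ 2 F
  periodic : ∀ α q t, F (α, q + 1, t) = F (α, q, t)
  burgers : ∀ x, fderiv ℝ F x (0, 0, 1) + F x * fderiv ℝ F x (0, 1, 0)
    + fderiv ℝ U x.2 (1, 0) = 0
  pos : ∀ x, 0 < fderiv ℝ F x (1, 0, 0)
  surjective : ∀ q t, Function.Surjective fun α => F (α, q, t)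

/-- The localized flux density `ω Φ` per unit label. -/
noncomputable def cutoffFlux (F : ℝ × ℝ × ℝ → ℝ) (N : ℝ) (x : ℝ × ℝ × ℝ) : ℝ :=
  fderiv ℝ F x (0, 1, 0) * logCutoff N (F x) x.2.2 * fderiv ℝ F x (1, 0, 0)

namespace IsBurgersFoliation

variable {U : ℝ × ℝ → ℝ} {F : ℝ × ℝ × ℝ → ℝ}

theorem contDiff_force (h : IsBurgersFoliation U F) :
    ContDiff ℝ 1 (fun y => fderiv ℝ U y (1, 0)) :=
  contDiff_one_fderiv_apply h.contDiff_potential _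

theorem hasDerivAt_force (h : IsBurgersFoliation U F) (q t : ℝ) :
    HasDerivAt (fun q' => fderiv ℝ U (q', t) (1, 0))
      (fderiv ℝ (fun y => fderiv ℝ U y (1, 0)) (q, t) (1, 0)) q :=
  (h.contDiff_force.differentiable (by norm_num) (q, t)).hasFDerivAt.comp_hasDerivAt
    (f := fun q' => (q', t)) q ((hasDerivAt_id q).prodMk (hasDerivAt_const q t))

theorem force_periodic (h : IsBurgersFoliation U F) (q t : ℝ) :
    fderiv ℝ U (q + 1, t) (1, 0) = fderiv ℝ U (q, t) (1, 0) := by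
  have e : (fun y : ℝ × ℝ => U (y + (1, 0))) = U := by
    ext ⟨q, t⟩; simpa using h.potential_periodic q t
  have := fderiv_comp_add_right (𝕜 := ℝ) (f := U) (x := (q, t)) (1, 0)
  rw [e] at this
  simp [this]

theorem fderiv_periodic (h : IsBurgersFoliation U F) (α q t : ℝ) :
    fderiv ℝ F (α, q + 1, t) = fderiv ℝ F (α, q, t) := by
  have e : (fun y : ℝ × ℝ × ℝ => F (y + (0, 1, 0))) = F := by
    ext ⟨α, q, t⟩; simpa using h.periodic α q t
  have := fderiv_comp_add_right (𝕜 := ℝ) (f := F) (x := (α, q, t)) (0, 1, 0)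
  rw [e] at this
  simp [this]

theorem differentiable (h : IsBurgersFoliation U F) : Differentiable ℝ F :=
  h.contDiff.differentiable (by norm_num)

theorem differentiable_partial (h : IsBurgersFoliation U F) (v : ℝ × ℝ × ℝ) :
    Differentiable ℝ (fun x => fderiv ℝ F x v) :=
  (contDiff_one_fderiv_apply h.contDiff v).differentiable (by norm_num)

theorem continuous_partial (h : IsBurgersFoliation U F) (v : ℝ × ℝ × ℝ) :
    Continuous (fun x => fderiv ℝ F x v) :=
  (contDiff_one_fderiv_apply h.contDiff v).continuous

theorem continuous_cutoff (h : IsBurgersFoliation U F) (N : ℝ) :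
    Continuous (fun x : ℝ × ℝ × ℝ => logCutoff N (F x) x.2.2) :=
  (contDiff_logCutoff N).continuous.comp (f := fun x : ℝ × ℝ × ℝ => (F x, x.2.2))
    (h.contDiff.continuous.prodMk (continuous_snd.comp continuous_snd))

theorem contDiff_cutoffFlux (h : IsBurgersFoliation U F) (N : ℝ) :
    ContDiff ℝ 1 (cutoffFlux F N) := by
  have h1 : ContDiff ℝ 1 (fun x : ℝ × ℝ × ℝ => logCutoff N (F x) x.2.2) :=
    (contDiff_logCutoff N).comp (f := fun x : ℝ × ℝ × ℝ => (F x, x.2.2))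
      ((h.contDiff.of_le (by norm_num)).prodMk (contDiff_snd.comp contDiff_snd))
  exact ((contDiff_one_fderiv_apply h.contDiff _).mul h1).mul
    (contDiff_one_fderiv_apply h.contDiff _)

/-- Mass conservation for the density `∂F/∂α`. -/
theorem burgers_fst (h : IsBurgersFoliation U F) (α q t : ℝ) :
    fderiv ℝ (fun x => fderiv ℝ F x (1, 0, 0)) (α, q, t) (0, 0, 1) =
      -(fderiv ℝ F (α, q, t) (1, 0, 0) * fderiv ℝ F (α, q, t) (0, 1, 0)
        + F (α, q, t) * fderiv ℝ (fun x => fderiv ℝ F x (1, 0, 0)) (α, q, t) (0, 1, 0)) := by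
  have h1 := ((hasDerivAt_fst_of_differentiable (h.differentiable_partial (0, 0, 1)) α q t).fun_add
    ((hasDerivAt_fst_of_differentiable h.differentiable α q t).fun_mul
      (hasDerivAt_fst_of_differentiable (h.differentiable_partial (0, 1, 0)) α q t))).fun_add
        (hasDerivAt_const α (fderiv ℝ U (q, t) (1, 0)))
  have h2 := h1.unique ((hasDerivAt_const α (0 : ℝ)).congr_of_eventuallyEq
    (Eventually.of_forall fun α' => h.burgers (α', q, t)))
  rw [fderiv_fderiv_apply_comm h.contDiff _ (0, 0, 1), fderiv_fderiv_apply_comm h.contDiff _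
    (0, 1, 0)] at h2
  linarith

/-- The Riccati equation for `∂F/∂q` along characteristics. -/
theorem burgers_fst_snd (h : IsBurgersFoliation U F) (α q t : ℝ) :
    fderiv ℝ (fun x => fderiv ℝ F x (0, 1, 0)) (α, q, t) (0, 0, 1) =
      -(fderiv ℝ F (α, q, t) (0, 1, 0) ^ 2
        + F (α, q, t) * fderiv ℝ (fun x => fderiv ℝ F x (0, 1, 0)) (α, q, t) (0, 1, 0)
        + fderiv ℝ (fun y => fderiv ℝ U y (1, 0)) (q, t) (1, 0)) := by
  have h1 := ((hasDerivAt_fst_snd_of_differentiable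
    (h.differentiable_partial (0, 0, 1)) α q t).fun_add
    ((hasDerivAt_fst_snd_of_differentiable h.differentiable α q t).fun_mul
      (hasDerivAt_fst_snd_of_differentiable (h.differentiable_partial (0, 1, 0)) α q t))).fun_add
        (h.hasDerivAt_force q t)
  have h2 := h1.unique ((hasDerivAt_const q (0 : ℝ)).congr_of_eventuallyEq
    (Eventually.of_forall fun q' => h.burgers (α, q', t)))
  rw [fderiv_fderiv_apply_comm h.contDiff _ (0, 0, 1)] at h2
  linarith

theorem divergence_cutoffFlux (h : IsBurgersFoliation U F) (N α q t : ℝ) :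
    fderiv ℝ (cutoffFlux F N) (α, q, t) (0, 0, 1)
      + fderiv ℝ (fun x => F x * cutoffFlux F N x) (α, q, t) (0, 1, 0) =
    fderiv ℝ F (α, q, t) (1, 0, 0) *
      (-(fderiv ℝ F (α, q, t) (0, 1, 0) ^ 2
          + fderiv ℝ (fun y => fderiv ℝ U y (1, 0)) (q, t) (1, 0))
          * logCutoff N (F (α, q, t)) t
        + fderiv ℝ F (α, q, t) (0, 1, 0) * (2 * max (logProfile N (F (α, q, t)) t) 0 *
          (-((2 * F (α, q, t) * (-fderiv ℝ U (q, t) (1, 0)) + 2 * t)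
            / (1 + F (α, q, t) ^ 2 + t ^ 2) / N)))) := by
  have hd := (h.contDiff_cutoffFlux N).differentiable (by norm_num)
  have t1 := hasDerivAt_snd_snd_of_differentiable hd α q t
  have t2 := ((hasDerivAt_snd_snd_of_differentiable
    (h.differentiable_partial (0, 1, 0)) α q t).fun_mul
      (hasDerivAt_logCutoff N (hasDerivAt_snd_snd_of_differentiable h.differentiable α q t)
        (hasDerivAt_id' t))).fun_mul
      (hasDerivAt_snd_snd_of_differentiable (h.differentiable_partial (1, 0, 0)) α q t)
  have q1 := hasDerivAt_fst_snd_of_differentiable (h.differentiable.fun_mul hd) α q t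
  have q2 := (hasDerivAt_fst_snd_of_differentiable h.differentiable α q t).fun_mul
    (((hasDerivAt_fst_snd_of_differentiable
    (h.differentiable_partial (0, 1, 0)) α q t).fun_mul
      (hasDerivAt_logCutoff N (hasDerivAt_fst_snd_of_differentiable h.differentiable α q t)
        (hasDerivAt_const q t))).fun_mul
      (hasDerivAt_fst_snd_of_differentiable (h.differentiable_partial (1, 0, 0)) α q t))
  rw [t1.unique t2, q1.unique q2, h.burgers_fst, h.burgers_fst_snd]
  have hb : fderiv ℝ F (α, q, t) (0, 0, 1) =
      -(F (α, q, t) * fderiv ℝ F (α, q, t) (0, 1, 0)) - fderiv ℝ U (q, t) (1, 0) := by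
    linarith [h.burgers (α, q, t)]
  rw [hb]
  ring

/-- All sheets with large label lie outside any prescribed band. -/
theorem exists_label_bound (h : IsBurgersFoliation U F) (S : ℝ) :
    ∃ A₀ : ℝ, ∀ A, A₀ ≤ A → ∀ q ∈ Icc (0 : ℝ) 1, ∀ t ∈ Icc (-S) S,
      S ≤ F (A, q, t) ∧ F (-A, q, t) ≤ -S := by
  have hmono : ∀ q t, StrictMono fun α => F (α, q, t) := fun q t =>
    strictMono_of_deriv_pos fun α => by
      rw [(hasDerivAt_fst_of_differentiable h.differentiable α q t).deriv]
      exact h.pos _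
  have hF := h.contDiff.continuous
  obtain ⟨n, hn⟩ := ((isCompact_Icc (a := (0 : ℝ)) (b := 1)).prod
    (isCompact_Icc (a := -S) (b := S))).elim_directed_cover
    (fun n : ℕ => {y : ℝ × ℝ | S < F (n, y.1, y.2)} ∩ {y : ℝ × ℝ | F (-n, y.1, y.2) < -S})
    (fun n => (isOpen_lt (by fun_prop) (by fun_prop)).inter
      (isOpen_lt (by fun_prop) (by fun_prop)))
    (fun y _ => by
      obtain ⟨a, ha⟩ := h.surjective y.1 y.2 S
      obtain ⟨b, hb⟩ := h.surjective y.1 y.2 (-S)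
      obtain ⟨n, hn⟩ := exists_nat_gt (max a (-b))
      refine mem_iUnion.2 ⟨n, ?_, ?_⟩
      · exact ha.symm.trans_lt (hmono y.1 y.2 ((le_max_left _ _).trans_lt hn))
      · refine lt_of_lt_of_eq (hmono y.1 y.2 ?_) hb
        linarith [le_max_right a (-b)])
    (directed_of_isDirected_le fun m n hmn y hy => by
      have hmn' : (m : ℝ) ≤ n := by exact_mod_cast hmn
      exact ⟨lt_of_lt_of_le hy.1 ((hmono y.1 y.2).monotone hmn'),
        lt_of_le_of_lt ((hmono y.1 y.2).monotone (neg_le_neg hmn')) hy.2⟩)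
  refine ⟨n, fun A hA q hq t ht => ?_⟩
  have := hn (mk_mem_prod hq ht)
  exact ⟨this.1.le.trans ((hmono q t).monotone hA),
    ((hmono q t).monotone (neg_le_neg hA)).trans this.2.le⟩

theorem integral_cutoff_mul_density (h : IsBurgersFoliation U F) {N S A q t : ℝ} (hN : 0 < N)
    (hS0 : 0 ≤ S) (hS : Real.exp N ≤ 1 + S ^ 2) (h1 : S ≤ F (A, q, t))
    (h2 : F (-A, q, t) ≤ -S) :
    ∫ α in (-A)..A, logCutoff N (F (α, q, t)) t * fderiv ℝ F (α, q, t) (1, 0, 0) =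
      ∫ p in (-S)..S, logCutoff N p t := by
  have hc : Continuous fun p => logCutoff N p t :=
    (contDiff_logCutoff N).continuous.comp (f := fun p : ℝ => (p, t)) (by fun_prop)
  have hp := h.continuous_partial (1, 0, 0)
  have hi : ∀ a b, IntervalIntegrable (fun p => logCutoff N p t) volume a b :=
    fun a b => hc.intervalIntegrable a b
  have e1 := intervalIntegral.integral_comp_mul_deriv (a := -A) (b := A)
    (f := fun α => F (α, q, t))
    (f' := fun α => fderiv ℝ F (α, q, t) (1, 0, 0)) (g := fun p => logCutoff N p t)
    (fun α _ => hasDerivAt_fst_of_differentiable h.differentiable α q t)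
    (Continuous.continuousOn (by fun_prop)) hc
  simp only [Function.comp_def] at e1
  rw [e1, ← intervalIntegral.integral_add_adjacent_intervals (hi _ (-S)) (hi (-S) _),
    ← intervalIntegral.integral_add_adjacent_intervals (hi (-S) S) (hi S _)]
  have z1 : ∫ p in F (-A, q, t)..(-S), logCutoff N p t = 0 := by
    refine (intervalIntegral.integral_congr (g := fun _ => 0) fun p hp => ?_).trans (by simp)
    rw [uIcc_of_le h2] at hp
    refine logCutoff_eq_zero hN ?_
    nlinarith [hp.2, sq_nonneg t]
  have z2 : ∫ p in S..F (A, q, t), logCutoff N p t = 0 := by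
    refine (intervalIntegral.integral_congr (g := fun _ => 0) fun p hp => ?_).trans (by simp)
    rw [uIcc_of_le h1] at hp
    refine logCutoff_eq_zero hN ?_
    nlinarith [hp.1, sq_nonneg t]
  rw [z1, z2]
  ring

theorem boxIntegral_forceDeriv_mul_cutoff (h : IsBurgersFoliation U F) {N S A : ℝ} (hN : 0 < N)
    (hS0 : 0 ≤ S) (hS : Real.exp N ≤ 1 + S ^ 2)
    (hA : ∀ q ∈ Icc (0 : ℝ) 1, ∀ t ∈ Icc (-S) S, S ≤ F (A, q, t) ∧ F (-A, q, t) ≤ -S) :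
    boxIntegral A S (fun x => fderiv ℝ (fun y => fderiv ℝ U y (1, 0)) x.2 (1, 0) *
      (logCutoff N (F x) x.2.2 * fderiv ℝ F x (1, 0, 0))) = 0 := by
  refine (intervalIntegral.integral_congr (g := fun _ => 0) fun t ht => ?_).trans (by simp)
  rw [uIcc_of_le (by linarith)] at ht
  have hc := continuous_fderiv_apply h.contDiff_force (1, 0)
  have e : ∫ q in (0 : ℝ)..1, fderiv ℝ (fun y => fderiv ℝ U y (1, 0)) (q, t) (1, 0) = 0 := by
    rw [intervalIntegral.integral_eq_sub_of_hasDerivAt (fun q _ => h.hasDerivAt_force q t)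
      (Continuous.intervalIntegrable (by fun_prop) _ _), sub_eq_zero]
    simpa using h.force_periodic 0 t
  calc _ = ∫ q in (0 : ℝ)..1, fderiv ℝ (fun y => fderiv ℝ U y (1, 0)) (q, t) (1, 0) *
          ∫ p in (-S)..S, logCutoff N p t := by
        refine intervalIntegral.integral_congr fun q hq => ?_
        rw [uIcc_of_le zero_le_one] at hq
        simp only [intervalIntegral.integral_const_mul]
        rw [h.integral_cutoff_mul_density hN hS0 hS (hA q hq t ht).1 (hA q hq t ht).2]
    _ = 0 := by rw [intervalIntegral.integral_mul_const, e, zero_mul]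

theorem integral_density_div_le (h : IsBurgersFoliation U F) (A q t : ℝ) :
    ∫ α in (-A)..A, fderiv ℝ F (α, q, t) (1, 0, 0) / (1 + F (α, q, t) ^ 2 + t ^ 2) ≤
      Real.pi * (√(1 + t ^ 2))⁻¹ := by
  have ha : 0 < √(1 + t ^ 2) := by positivity
  have ha2 : √(1 + t ^ 2) ^ 2 = 1 + t ^ 2 := Real.sq_sqrt (by positivity)
  set a := √(1 + t ^ 2)
  have hF := h.contDiff.continuous
  have hp := h.continuous_partial (1, 0, 0)
  have hd : ∀ α, HasDerivAt (fun α' => Real.arctan (F (α', q, t) / a) / a)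
      (fderiv ℝ F (α, q, t) (1, 0, 0) / (1 + F (α, q, t) ^ 2 + t ^ 2)) α := fun α => by
    refine HasDerivAt.congr_deriv
      (((hasDerivAt_fst_of_differentiable h.differentiable α q t).div_const a).arctan.div_const a) ?_
    have : 1 + F (α, q, t) ^ 2 + t ^ 2 = a ^ 2 + F (α, q, t) ^ 2 := by rw [ha2]; ring
    rw [this]
    field_simp
  rw [intervalIntegral.integral_eq_sub_of_hasDerivAt (fun α _ => hd α)
    (Continuous.intervalIntegrable (Continuous.div (by fun_prop) (by fun_prop)
      fun α => (one_add_sq_add_sq_pos _ _).ne') _ _), ← sub_div, div_eq_mul_inv]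
  gcongr
  linarith [Real.arctan_lt_pi_div_two (F (A, q, t) / a),
    Real.neg_pi_div_two_lt_arctan (F (-A, q, t) / a)]

theorem continuous_energyDensity (h : IsBurgersFoliation U F) :
    Continuous (fun x : ℝ × ℝ × ℝ => (1 + fderiv ℝ U x.2 (1, 0) ^ 2) *
      (fderiv ℝ F x (1, 0, 0) / (1 + F x ^ 2 + x.2.2 ^ 2))) := by
  have hF := h.contDiff.continuous
  have hp := h.continuous_partial (1, 0, 0)
  have hU := h.contDiff_force.continuous
  exact Continuous.mul (by fun_prop) (Continuous.div (by fun_prop) (by fun_prop)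
      fun x => (one_add_sq_add_sq_pos _ _).ne')

theorem boxIntegral_energyDensity_le (h : IsBurgersFoliation U F) {K : ℝ}
    (hK : ∀ t, ∫ q in (0 : ℝ)..1, fderiv ℝ U (q, t) (1, 0) ^ 2 ≤ K) {S : ℝ} (hS : 0 ≤ S) (A : ℝ) :
    boxIntegral A S (fun x => (1 + fderiv ℝ U x.2 (1, 0) ^ 2) *
      (fderiv ℝ F x (1, 0, 0) / (1 + F x ^ 2 + x.2.2 ^ 2))) ≤
        (1 + K) * Real.pi * (2 * Real.arsinh S) := by
  have hc := h.continuous_energyDensity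
  have hU := h.contDiff_force.continuous
  rw [← integral_inv_sqrt_one_add_sq, ← intervalIntegral.integral_const_mul]
  refine intervalIntegral.integral_mono_on (by linarith)
    ((continuous_integral_fst_snd hc).intervalIntegrable _ _)
    (Continuous.intervalIntegrable (continuous_const.mul
      (Continuous.inv₀ (by fun_prop) fun t => by positivity)) _ _) fun t _ => ?_
  calc _ ≤ ∫ q in (0 : ℝ)..1, (1 + fderiv ℝ U (q, t) (1, 0) ^ 2) *
          (Real.pi * (√(1 + t ^ 2))⁻¹) := by
        refine intervalIntegral.integral_mono_on zero_le_one
          ((continuous_integral_fst hc t).intervalIntegrable _ _)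
          (Continuous.intervalIntegrable (by fun_prop) _ _) fun q _ => ?_
        simp only [intervalIntegral.integral_const_mul]
        gcongr
        exact h.integral_density_div_le A q t
    _ = (1 + ∫ q in (0 : ℝ)..1, fderiv ℝ U (q, t) (1, 0) ^ 2) *
          (Real.pi * (√(1 + t ^ 2))⁻¹) := by
        rw [intervalIntegral.integral_mul_const, intervalIntegral.integral_add
          (by simp) (Continuous.intervalIntegrable (by fun_prop) _ _)]
        simp
    _ ≤ (1 + K) * Real.pi * (√(1 + t ^ 2))⁻¹ := by
        rw [mul_assoc]
        gcongr
        exact hK t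

theorem boxIntegral_cutoff_energy_le (h : IsBurgersFoliation U F) {K : ℝ}
    (hK : ∀ t, ∫ q in (0 : ℝ)..1, fderiv ℝ U (q, t) (1, 0) ^ 2 ≤ K) {N A : ℝ} (hN : 1 ≤ N)
    (hA0 : 0 ≤ A)
    (hA : ∀ q ∈ Icc (0 : ℝ) 1, ∀ t ∈ Icc (-Real.sinh (2 * N)) (Real.sinh (2 * N)),
      Real.sinh (2 * N) ≤ F (A, q, t) ∧ F (-A, q, t) ≤ -Real.sinh (2 * N)) :
    boxIntegral A (Real.sinh (2 * N)) (fun x => fderiv ℝ F x (0, 1, 0) ^ 2 *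
      logCutoff N (F x) x.2.2 * fderiv ℝ F x (1, 0, 0)) ≤ 64 * Real.pi * (1 + K) / N := by
  have hN0 : 0 < N := by linarith
  have hexp := exp_le_one_add_sinh_sq hN
  have hS0 : 0 ≤ Real.sinh (2 * N) := Real.sinh_nonneg_iff.2 (by linarith)
  have hD := h.boxIntegral_energyDensity_le hK hS0 A
  rw [Real.arsinh_sinh] at hD
  have hU := h.boxIntegral_forceDeriv_mul_cutoff hN0 hS0 hexp hA
  set S := Real.sinh (2 * N)
  have hflux := h.contDiff_cutoffFlux N
  have hFflux : ContDiff ℝ 1 (fun x => F x * cutoffFlux F N x) :=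
    (h.contDiff.of_le (by norm_num)).mul hflux
  have c1 := continuous_fderiv_apply hflux (0, 0, 1)
  have c2 := continuous_fderiv_apply hFflux (0, 1, 0)
  have z1 : boxIntegral A S (fun x => fderiv ℝ (cutoffFlux F N) x (0, 0, 1)) = 0 := by
    refine boxIntegral_eq_zero_of_hasDerivAt_snd_snd c1 (fun α q t =>
      hasDerivAt_snd_snd_of_differentiable (hflux.differentiable (by norm_num)) α q t) ?_ ?_
    all_goals
      intro α q
      rw [cutoffFlux, logCutoff_eq_zero hN0, mul_zero, zero_mul]
      dsimp only
      nlinarith [sq_nonneg (F (α, q, S)), sq_nonneg (F (α, q, -S))]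
  have z2 : boxIntegral A S (fun x => fderiv ℝ (fun x => F x * cutoffFlux F N x) x (0, 1, 0))
      = 0 := by
    refine boxIntegral_eq_zero_of_hasDerivAt_fst_snd (g := fun x => F x * cutoffFlux F N x)
      c2 (fun α q t =>
      hasDerivAt_fst_snd_of_differentiable (hFflux.differentiable (by norm_num)) α q t) ?_
    intro α t
    have e1 := h.periodic α 0 t
    have e2 := h.fderiv_periodic α 0 t
    rw [zero_add] at e1 e2
    simp only [cutoffFlux, e1, e2]
  have hF := h.contDiff.continuous
  have ca := h.continuous_partial (1, 0, 0)
  have cq := h.continuous_partial (0, 1, 0)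
  have cΦ := h.continuous_cutoff N
  have cf := continuous_fderiv_apply h.contDiff_force (1, 0)
  have cE := h.continuous_energyDensity
  have cG : Continuous fun x => fderiv ℝ F x (0, 1, 0) ^ 2 *
      logCutoff N (F x) x.2.2 * fderiv ℝ F x (1, 0, 0) := by fun_prop
  have cH : Continuous fun x : ℝ × ℝ × ℝ => fderiv ℝ (fun y => fderiv ℝ U y (1, 0)) x.2 (1, 0) *
      (logCutoff N (F x) x.2.2 * fderiv ℝ F x (1, 0, 0)) := by fun_prop
  have hmono : boxIntegral A S (fun x => (fderiv ℝ (cutoffFlux F N) x (0, 0, 1) +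
        fderiv ℝ (fun x => F x * cutoffFlux F N x) x (0, 1, 0)) +
      (1 / 2 * (fderiv ℝ F x (0, 1, 0) ^ 2 * logCutoff N (F x) x.2.2 * fderiv ℝ F x (1, 0, 0)) +
        fderiv ℝ (fun y => fderiv ℝ U y (1, 0)) x.2 (1, 0) *
          (logCutoff N (F x) x.2.2 * fderiv ℝ F x (1, 0, 0)))) ≤
      boxIntegral A S (fun x => 8 / N ^ 2 * ((1 + fderiv ℝ U x.2 (1, 0) ^ 2) *
        (fderiv ℝ F x (1, 0, 0) / (1 + F x ^ 2 + x.2.2 ^ 2)))) := by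
    refine boxIntegral_mono hA0 hS0 ((c1.add c2).add ((continuous_const.mul cG).add cH))
      (continuous_const.mul cE) fun α _ q _ t _ => ?_
    rw [h.divergence_cutoffFlux]
    have hy := mul_le_mul_of_nonneg_left (cutoff_young_le (N := N)
      (w := fderiv ℝ F (α, q, t) (0, 1, 0))
      (m := max (logProfile N (F (α, q, t)) t) 0) (p := F (α, q, t)) (t := t)
      (v := fderiv ℝ U (q, t) (1, 0))) (h.pos (α, q, t)).le
    have hl : logCutoff N (F (α, q, t)) t = max (logProfile N (F (α, q, t)) t) 0 ^ 2 := rfl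
    rw [hl]
    linear_combination hy
  rw [boxIntegral_add (c1.fun_add c2) ((continuous_const.fun_mul cG).fun_add cH),
    boxIntegral_add c1 c2, boxIntegral_add (continuous_const.fun_mul cG) cH,
    boxIntegral_const_mul, boxIntegral_const_mul, z1, z2, hU] at hmono
  have hD' := mul_le_mul_of_nonneg_left hD (by positivity : 0 ≤ 8 / N ^ 2)
  have e : 64 * Real.pi * (1 + K) / N
      = 2 * (8 / N ^ 2 * ((1 + K) * Real.pi * (2 * (2 * N)))) := by
    field_simp; ring
  rw [e]
  linarith

theorem fderiv_space_eq_zero (h : IsBurgersFoliation U F) {K : ℝ}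
    (hK : ∀ t, ∫ q in (0 : ℝ)..1, fderiv ℝ U (q, t) (1, 0) ^ 2 ≤ K) (α q t : ℝ) :
    fderiv ℝ F (α, q, t) (0, 1, 0) = 0 := by
  wlog hq : q ∈ Icc (0 : ℝ) 1 generalizing q
  · have hper : Function.Periodic (fun q => fderiv ℝ F (α, q, t) (0, 1, 0)) 1 :=
      fun q => by simp only [h.fderiv_periodic]
    obtain ⟨q', hq', e⟩ := hper.exists_mem_Ico₀ one_pos q
    exact e.trans (this q' ⟨hq'.1, hq'.2.le⟩)
  by_contra hne
  have hF := h.contDiff.continuous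
  have ca := h.continuous_partial (1, 0, 0)
  have cq := h.continuous_partial (0, 1, 0)
  have cg : Continuous fun x => fderiv ℝ F x (0, 1, 0) ^ 2 * fderiv ℝ F x (1, 0, 0) := by fun_prop
  have hg0 : ∀ x, 0 ≤ fderiv ℝ F x (0, 1, 0) ^ 2 * fderiv ℝ F x (1, 0, 0) :=
    fun x => mul_nonneg (sq_nonneg _) (h.pos x).le
  have hA : 0 < |α| + 1 := by positivity
  have hS : 0 < |t| + 1 := by positivity
  have hpos := boxIntegral_pos hA hS cg hg0 (α := α) (q := q) (t := t)
    (abs_le.1 (by linarith)) hq (abs_le.1 (by linarith))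
    (mul_pos (pow_pos (abs_pos.2 hne) 2 |>.trans_eq (sq_abs _)) (h.pos _))
  obtain ⟨B, hB⟩ := ((isCompact_Icc (a := -(|α| + 1)) (b := |α| + 1)).prod
    ((isCompact_Icc (a := (0 : ℝ)) (b := 1)).prod
      (isCompact_Icc (a := -(|t| + 1)) (b := |t| + 1)))).exists_bound_of_continuousOn
    (f := fun x : ℝ × ℝ × ℝ => Real.log (1 + F x ^ 2 + x.2.2 ^ 2))
    (Continuous.continuousOn (Continuous.log (by fun_prop)
      fun x => (one_add_sq_add_sq_pos _ _).ne'))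
  set I := boxIntegral (|α| + 1) (|t| + 1)
    (fun x => fderiv ℝ F x (0, 1, 0) ^ 2 * fderiv ℝ F x (1, 0, 0)) with hI
  have key : ∀ N, max (max 1 (2 * B)) (|t| + 1) ≤ N →
      I / 4 ≤ 64 * Real.pi * (1 + K) / N := fun N hN => by
    have hN1 : 1 ≤ N := (le_max_left _ _).trans ((le_max_left _ _).trans hN)
    have hN2 : 2 * B ≤ N := (le_max_right _ _).trans ((le_max_left _ _).trans hN)
    have hN3 : |t| + 1 ≤ N := (le_max_right _ _).trans hN
    have hsinh : 2 * N ≤ Real.sinh (2 * N) := Real.self_le_sinh_iff.2 (by linarith)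
    obtain ⟨A₀, hA₀⟩ := h.exists_label_bound (Real.sinh (2 * N))
    have hE := h.boxIntegral_cutoff_energy_le hK hN1 (A := max A₀ (|α| + 1))
      (hA.le.trans (le_max_right _ _)) (hA₀ _ (le_max_left _ _))
    have cΦ := h.continuous_cutoff N
    have cG : Continuous fun x => fderiv ℝ F x (0, 1, 0) ^ 2 *
      logCutoff N (F x) x.2.2 * fderiv ℝ F x (1, 0, 0) := by fun_prop
    refine le_trans ?_ hE
    refine le_trans ?_ (boxIntegral_mono_box hA.le hS.le (le_max_right A₀ _)
      (by linarith : |t| + 1 ≤ Real.sinh (2 * N)) cG fun x =>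
        mul_nonneg (mul_nonneg (sq_nonneg _) (sq_nonneg _)) (h.pos x).le)
    have e : I / 4 = 1 / 4 * I := by ring
    rw [e, hI, ← boxIntegral_const_mul]
    refine boxIntegral_mono hA.le hS.le (continuous_const.mul cg) cG fun α' hα' q' hq' t' ht' => ?_
    have hlog := (le_abs_self _).trans (hB (α', q', t') ⟨hα', hq', ht'⟩)
    have hΦ := one_fourth_le_logCutoff (N := N) (p := F (α', q', t')) (t := t') (by linarith)
      (by linarith)
    have := mul_le_mul_of_nonneg_right hΦ (hg0 (α', q', t'))
    linarith
  have hlim : Tendsto (fun N : ℝ => 64 * Real.pi * (1 + K) / N) atTop (𝓝 0) :=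
    tendsto_const_nhds.div_atTop tendsto_id
  have := ge_of_tendsto hlim ((eventually_ge_atTop _).mono key)
  linarith

theorem force_eq_zero (h : IsBurgersFoliation U F) {K : ℝ}
    (hK : ∀ t, ∫ q in (0 : ℝ)..1, fderiv ℝ U (q, t) (1, 0) ^ 2 ≤ K) (q t : ℝ) :
    fderiv ℝ U (q, t) (1, 0) = 0 := by
  have hconst : ∀ q t, F (0, q, t) = F (0, 0, t) := fun q t =>
    is_const_of_deriv_eq_zero (f := fun q => F (0, q, t))
      (fun q => (hasDerivAt_fst_snd_of_differentiable h.differentiable 0 q t).differentiableAt)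
      (fun q => by
        rw [(hasDerivAt_fst_snd_of_differentiable h.differentiable 0 q t).deriv,
          h.fderiv_space_eq_zero hK]) q 0
  have hforce : ∀ q, fderiv ℝ U (q, t) (1, 0) = fderiv ℝ U (0, t) (1, 0) := fun q => by
    have e1 := (hasDerivAt_snd_snd_of_differentiable h.differentiable 0 q t).unique
      ((hasDerivAt_snd_snd_of_differentiable h.differentiable 0 0 t).congr_of_eventuallyEq
        (Eventually.of_forall fun t' => hconst q t'))
    have e2 := h.burgers (0, q, t)
    have e3 := h.burgers (0, 0, t)
    rw [h.fderiv_space_eq_zero hK] at e2 e3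
    linarith
  have hd : ∀ q, HasDerivAt (fun q' => U (q', t)) (fderiv ℝ U (0, t) (1, 0)) q := fun q => by
    rw [← hforce q]
    exact (h.contDiff_potential.differentiable (by norm_num) (q, t)).hasFDerivAt.comp_hasDerivAt
      (f := fun q' => (q', t)) q ((hasDerivAt_id q).prodMk (hasDerivAt_const q t))
  have hftc := intervalIntegral.integral_eq_sub_of_hasDerivAt (a := 0) (b := 1)
    (fun q _ => hd q) (by simp)
  have hp := h.potential_periodic 0 t
  rw [zero_add] at hp
  rw [hforce]
  simpa [hp] using hftc

end IsBurgersFoliation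

theorem deriv_ne_zero_of_differentiable_invFun {g : ℝ → ℝ} (hg : Function.Injective g)
    (hd : Differentiable ℝ g) (hinv : Differentiable ℝ (Function.invFun g)) (x : ℝ) :
    deriv g x ≠ 0 := fun h0 => by
  have h1 := (hinv (g x)).hasDerivAt.comp x (hd x).hasDerivAt
  rw [Function.invFun_comp hg] at h1
  have := h1.unique (hasDerivAt_id x)
  simp [h0] at this

/-- (Shock formation, Theorem 1.)  Let `u(q,t)` be a `C²` potential,
`1`-periodic in `q`, with `∫₀¹ u_q² dq < K` for all `t`, whose force `F = u_q` is not
identically zero.  Then there is no `C²` family `f(α,q,t)` of globally defined classical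
solutions of the forced Burgers equation `f_t + f·f_q + u_q = 0`, `1`-periodic in `q`,
such that for each `(q,t)` the map `α ↦ f(α,q,t)` is a `C²` diffeomorphism of `ℝ`;
i.e. for any foliated initial data some solution develops a shock in finite positive or
negative time. -/
theorem no_global_foliated_family_for_nonzero_force
    (u : ℝ → ℝ → ℝ) (hu : ContDiff ℝ 2 (fun x : ℝ × ℝ => u x.1 x.2))
    (huper : ∀ q t, u (q + 1) t = u q t)
    (uq : ℝ → ℝ → ℝ)
    (huq : ∀ q t, HasDerivAt (fun q' => u q' t) (uq q t) q)
    (K : ℝ) (hK : 0 < K)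
    (hbound : ∀ t, (∫ q in (0:ℝ)..1, (uq q t) ^ 2) < K)
    (hforce : ∃ q t, uq q t ≠ 0) :
    ¬ ∃ f : ℝ → ℝ → ℝ → ℝ,
      ContDiff ℝ 2 (fun x : ℝ × ℝ × ℝ => f x.1 x.2.1 x.2.2) ∧
      (∀ α q t, f α (q + 1) t = f α q t) ∧
      (∀ α q t,
        deriv (fun t' => f α q t') t + f α q t * deriv (fun q' => f α q' t) q
          + uq q t = 0) ∧
      (∀ q t, Function.Bijective (fun α => f α q t) ∧
        ContDiff ℝ 2 (Function.invFun (fun α => f α q t))) := by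
  rintro ⟨f, hf, hfper, hpde, hdiff⟩
  set U : ℝ × ℝ → ℝ := fun x => u x.1 x.2 with hU
  set F : ℝ × ℝ × ℝ → ℝ := fun x => f x.1 x.2.1 x.2.2 with hF
  have hUd : Differentiable ℝ U := hu.differentiable (by norm_num)
  have hFd : Differentiable ℝ F := hf.differentiable (by norm_num)
  have huqU : ∀ q t, fderiv ℝ U (q, t) (1, 0) = uq q t := fun q t =>
    HasDerivAt.unique ((hUd (q, t)).hasFDerivAt.comp_hasDerivAt (f := fun q' => (q', t)) q
      ((hasDerivAt_id q).prodMk (hasDerivAt_const q t))) (huq q t)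
  have hne : ∀ x, fderiv ℝ F x (1, 0, 0) ≠ 0 := fun ⟨α, q, t⟩ => by
    have hα := hasDerivAt_fst_of_differentiable hFd
    rw [← (hα α q t).deriv]
    exact deriv_ne_zero_of_differentiable_invFun (hdiff q t).1.1
      (fun α => (hα α q t).differentiableAt) ((hdiff q t).2.differentiable (by norm_num)) α
  have hburgers : ∀ x, fderiv ℝ F x (0, 0, 1) + F x * fderiv ℝ F x (0, 1, 0)
      + fderiv ℝ U x.2 (1, 0) = 0 := fun ⟨α, q, t⟩ => by
    rw [huqU, ← (hasDerivAt_snd_snd_of_differentiable hFd α q t).deriv,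
      ← (hasDerivAt_fst_snd_of_differentiable hFd α q t).deriv]
    exact hpde α q t
  have hK' : ∀ t, ∫ q in (0 : ℝ)..1, fderiv ℝ U (q, t) (1, 0) ^ 2 ≤ K := fun t => by
    simp only [huqU]
    exact (hbound t).le
  obtain ⟨q, t, hqt⟩ := hforce
  refine hqt ?_
  rw [← huqU]
  have hcont := (contDiff_one_fderiv_apply hf (1, 0, 0)).continuous
  by_cases hneg : ∃ x, fderiv ℝ F x (1, 0, 0) ≤ 0
  · have hlt : ∀ x, fderiv ℝ F x (1, 0, 0) < 0 := fun x => by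
      by_contra! hx
      obtain ⟨y, hy⟩ := mem_range_of_exists_le_of_exists_ge hcont hneg ⟨x, hx⟩
      exact hne y hy
    set G : ℝ × ℝ × ℝ → ℝ := fun x => F (-x.1, x.2) with hG
    have hGc : ContDiff ℝ 2 G := hf.comp (contDiff_fst.neg.prodMk contDiff_snd)
    have hGd : Differentiable ℝ G := hGc.differentiable (by norm_num)
    refine IsBurgersFoliation.force_eq_zero (F := G)
      ⟨hu, huper, hGc, fun α => hfper (-α), fun ⟨α, q, t⟩ => ?_, fun ⟨α, q, t⟩ => ?_,
        fun q t => (hdiff q t).1.2.comp neg_surjective⟩ hK' q t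
    · rw [(hasDerivAt_snd_snd_of_differentiable hGd α q t).unique
        (hasDerivAt_snd_snd_of_differentiable hFd (-α) q t),
        (hasDerivAt_fst_snd_of_differentiable hGd α q t).unique
        (hasDerivAt_fst_snd_of_differentiable hFd (-α) q t)]
      exact hburgers (-α, q, t)
    · rw [(hasDerivAt_fst_of_differentiable hGd α q t).unique
        ((hasDerivAt_fst_of_differentiable hFd (-α) q t).comp α (hasDerivAt_neg α))]
      linarith [hlt (-α, q, t)]
  · push Not at hneg
    exact IsBurgersFoliation.force_eq_zero ⟨hu, huper, hf, hfper, hburgers, hneg,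
      fun q t => (hdiff q t).1.2⟩ hK' q t
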